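/- arXiv:1710.11457 — 4 statements merged into one kernel-verified Lean document; each statement's English description precedes it below -/
import Mathlib

section
/- Let E, B, P, J be twice continuously differentiable ℝ³-valued fields on ℝ³×[0,T] satisfying the Ampère–Maxwell law ∂ₜE = c∇×B − 4π∂ₜP − 4πJ and the Faraday law ∂ₜB = −c∇×E, with B satisfying the Dirichlet support condition. Then ‖∂ₜB(·,T)‖²_{L²(Ω)} + c²‖∇×B(·,T)‖²_{L²(Ω)} = ‖∂ₜB(·,0)‖²_{L²(Ω)} + c²‖∇×B(·,0)‖²_{L²(Ω)} + 8πc∫₀ᵀ∫_Ω ∂ₜB(x,t)·∂ₜ(∇×P)(x,t) dx dt + 8πc∫₀ᵀ∫_Ω ∂ₜB(x,t)·(∇×J)(x,t) dx dt. -/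
open MeasureTheory
open scoped RealInnerProductSpace

noncomputable section

/-- `V3` is Euclidean three-dimensional space. -/
abbrev V3 : Type := EuclideanSpace ℝ (Fin 3)

/-- spatial partial derivative in direction `i` of a scalar field -/
def pd (i : Fin 3) (g : V3 → ℝ) (x : V3) : ℝ :=
  fderiv ℝ g x (EuclideanSpace.single i 1)

/-- spatial divergence of a vector field -/
def sdiv (F : V3 → V3) (x : V3) : ℝ := ∑ i, pd i (fun y => F y i) x

/-- build a vector in `V3` from three coordinates -/
def vec3 (a b c : ℝ) : V3 := (WithLp.equiv 2 (Fin 3 → ℝ)).symm ![a, b, c]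

/-- spatial curl of a vector field -/
def scurl (F : V3 → V3) (x : V3) : V3 :=
  vec3 (pd 1 (fun y => F y 2) x - pd 2 (fun y => F y 1) x)
       (pd 2 (fun y => F y 0) x - pd 0 (fun y => F y 2) x)
       (pd 0 (fun y => F y 1) x - pd 1 (fun y => F y 0) x)

/-- spatial gradient of a scalar field -/
def sgrad (g : V3 → ℝ) (x : V3) : V3 :=
  (WithLp.equiv 2 (Fin 3 → ℝ)).symm (fun i => pd i g x)

/-- spatial Laplacian of a scalar field -/
def slap (g : V3 → ℝ) (x : V3) : ℝ := ∑ i, pd i (fun y => pd i g y) x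

/-- componentwise spatial Laplacian of a vector field -/
def veclap (F : V3 → V3) (x : V3) : V3 :=
  (WithLp.equiv 2 (Fin 3 → ℝ)).symm (fun i => slap (fun y => F y i) x)

/-- cross product on `V3` -/
def cross3 (a b : V3) : V3 :=
  vec3 (a 1 * b 2 - a 2 * b 1) (a 2 * b 0 - a 0 * b 2) (a 0 * b 1 - a 1 * b 0)

/-- The Dirichlet support condition: for every `t ∈ [0,T]` the spatial support of the
field is contained in a fixed compact subset of `Ω` (encoding zero Dirichlet BCs). -/
def DirichletBC {α : Type} [Zero α] (Ω : Set V3) (T : ℝ) (F : V3 → ℝ → α) : Prop :=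
  ∃ K : Set V3, IsCompact K ∧ K ⊆ Ω ∧
    ∀ t ∈ Set.Icc (0:ℝ) T, (Function.support fun x => F x t) ⊆ K

/-- The coordinate direction `i` of space, as a direction of space-time. -/
def spaceDir (i : Fin 3) : V3 × ℝ := (EuclideanSpace.single i 1, 0)

/-- The time direction of space-time. -/
def timeDir : V3 × ℝ := (0, 1)

/-- The derivative of a scalar function on space-time in the direction `v`. -/
def dirDeriv (v : V3 × ℝ) (f : V3 × ℝ → ℝ) (p : V3 × ℝ) : ℝ := fderiv ℝ f p v

/-- The spatial curl, in components indexed cyclically by `Fin 3`. -/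
def curlComp (b : Fin 3 → V3 × ℝ → ℝ) (i : Fin 3) (p : V3 × ℝ) : ℝ :=
  dirDeriv (spaceDir (i + 1)) (b (i + 2)) p - dirDeriv (spaceDir (i + 2)) (b (i + 1)) p

/-- The components of a time-dependent vector field, as functions on space-time. -/
def comps (F : V3 → ℝ → V3) (i : Fin 3) (p : V3 × ℝ) : ℝ := F p.1 p.2 i

section DirDeriv

variable {f g : V3 × ℝ → ℝ} {p v : V3 × ℝ}

theorem contDiff_dirDeriv (hf : ContDiff ℝ 2 f) (v : V3 × ℝ) : ContDiff ℝ 1 (dirDeriv v f) :=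
  (hf.fderiv_right (m := 1) (by norm_num)).clm_apply contDiff_const

theorem continuous_dirDeriv (hf : ContDiff ℝ 1 f) (v : V3 × ℝ) : Continuous (dirDeriv v f) :=
  (hf.continuous_fderiv (by norm_num)).clm_apply continuous_const

theorem dirDeriv_comm (hf : ContDiff ℝ 2 f) (v w p : V3 × ℝ) :
    dirDeriv v (dirDeriv w f) p = dirDeriv w (dirDeriv v f) p := by
  have hd : DifferentiableAt ℝ (fderiv ℝ f) p :=
    (hf.fderiv_right (m := 1) (by norm_num)).differentiable (by norm_num) p
  have key : ∀ a b : V3 × ℝ,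
      dirDeriv a (dirDeriv b f) p = fderiv ℝ (fderiv ℝ f) p a b := by
    intro a b
    change fderiv ℝ (fun q => fderiv ℝ f q b) p a = _
    rw [fderiv_clm_apply hd (differentiableAt_const b)]
    simp
  rw [key, key]
  exact (hf.contDiffAt.isSymmSndFDerivAt (by simp)) v w

theorem dirDeriv_congr (h : f =ᶠ[nhds p] g) : dirDeriv v f p = dirDeriv v g p := by
  simp only [dirDeriv, h.fderiv_eq]

theorem dirDeriv_sub (hf : DifferentiableAt ℝ f p) (hg : DifferentiableAt ℝ g p) :
    dirDeriv v (fun q => f q - g q) p = dirDeriv v f p - dirDeriv v g p := by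
  simp [dirDeriv, fderiv_fun_sub hf hg]

theorem dirDeriv_add (hf : DifferentiableAt ℝ f p) (hg : DifferentiableAt ℝ g p) :
    dirDeriv v (fun q => f q + g q) p = dirDeriv v f p + dirDeriv v g p := by
  simp [dirDeriv, fderiv_fun_add hf hg]

theorem dirDeriv_mul (hf : DifferentiableAt ℝ f p) (hg : DifferentiableAt ℝ g p) :
    dirDeriv v (fun q => f q * g q) p = f p * dirDeriv v g p + g p * dirDeriv v f p := by
  simp [dirDeriv, fderiv_fun_mul hf hg]

theorem dirDeriv_const_mul (hf : DifferentiableAt ℝ f p) (c : ℝ) :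
    dirDeriv v (fun q => c * f q) p = c * dirDeriv v f p := by
  simp [dirDeriv, fderiv_const_mul hf c]

theorem dirDeriv_sum {ι : Type*} {s : Finset ι} {F : ι → V3 × ℝ → ℝ}
    (hF : ∀ i ∈ s, DifferentiableAt ℝ (F i) p) :
    dirDeriv v (fun q => ∑ i ∈ s, F i q) p = ∑ i ∈ s, dirDeriv v (F i) p := by
  simp [dirDeriv, fderiv_fun_sum hF]

theorem hasDerivAt_timeDir {x : V3} {t : ℝ} (hf : DifferentiableAt ℝ f (x, t)) :
    HasDerivAt (fun s => f (x, s)) (dirDeriv timeDir f (x, t)) t :=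
  hf.hasFDerivAt.comp_hasDerivAt t ((hasDerivAt_const t x).prodMk (hasDerivAt_id t))

theorem hasFDerivAt_slice {x : V3} {t : ℝ} (hf : DifferentiableAt ℝ f (x, t)) :
    HasFDerivAt (fun y => f (y, t)) ((fderiv ℝ f (x, t)).comp (.inl ℝ V3 ℝ)) x :=
  hf.hasFDerivAt.comp x (hasFDerivAt_prodMk_left x t)

theorem fderiv_slice_apply_single {x : V3} {t : ℝ} (hf : DifferentiableAt ℝ f (x, t)) (i : Fin 3) :
    fderiv ℝ (fun y => f (y, t)) x (EuclideanSpace.single i 1)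
      = dirDeriv (spaceDir i) f (x, t) := by
  rw [(hasFDerivAt_slice hf).fderiv]
  simp [dirDeriv, spaceDir]

end DirDeriv

section Curl

variable {b a h : Fin 3 → V3 × ℝ → ℝ}

theorem contDiff_curlComp (hb : ∀ i, ContDiff ℝ 2 (b i)) (i : Fin 3) :
    ContDiff ℝ 1 (curlComp b i) :=
  (contDiff_dirDeriv (hb _) _).sub (contDiff_dirDeriv (hb _) _)

theorem continuous_curlComp (hb : ∀ i, ContDiff ℝ 1 (b i)) (i : Fin 3) :
    Continuous (curlComp b i) :=
  (continuous_dirDeriv (hb _) _).sub (continuous_dirDeriv (hb _) _)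

theorem dirDeriv_curlComp (hb : ∀ i, ContDiff ℝ 2 (b i)) (v : V3 × ℝ) (i : Fin 3) (p : V3 × ℝ) :
    dirDeriv v (curlComp b i) p = curlComp (fun k => dirDeriv v (b k)) i p := by
  have hd : ∀ w k, DifferentiableAt ℝ (dirDeriv w (b k)) p := fun w k =>
    (contDiff_dirDeriv (hb k) w).differentiable (by norm_num) p
  change dirDeriv v (fun q => dirDeriv _ _ q - dirDeriv _ _ q) p = _
  rw [dirDeriv_sub (hd _ _) (hd _ _), dirDeriv_comm (hb _), dirDeriv_comm (hb _) v]
  rfl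

/-- The divergence of `a × h` is `h · curl a - a · curl h`. -/
theorem sum_dirDeriv_cross {p : V3 × ℝ} (ha : ∀ i, DifferentiableAt ℝ (a i) p)
    (hh : ∀ i, DifferentiableAt ℝ (h i) p) :
    ∑ j, dirDeriv (spaceDir j)
        (fun q => a (j + 1) q * h (j + 2) q - a (j + 2) q * h (j + 1) q) p
      = ∑ i, h i p * curlComp a i p - ∑ i, a i p * curlComp h i p := by
  have key : ∀ j, dirDeriv (spaceDir j)
        (fun q => a (j + 1) q * h (j + 2) q - a (j + 2) q * h (j + 1) q) p
      = (a (j + 1) p * dirDeriv (spaceDir j) (h (j + 2)) p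
          + h (j + 2) p * dirDeriv (spaceDir j) (a (j + 1)) p)
        - (a (j + 2) p * dirDeriv (spaceDir j) (h (j + 1)) p
          + h (j + 1) p * dirDeriv (spaceDir j) (a (j + 2)) p) := fun j => by
    rw [dirDeriv_sub ((ha _).fun_mul (hh _)) ((ha _).fun_mul (hh _)), dirDeriv_mul (ha _) (hh _),
      dirDeriv_mul (ha _) (hh _)]
  simp only [key, curlComp, Fin.sum_univ_three]
  have e1 : (1 : Fin 3) + 1 = 2 := rfl
  have e2 : (1 : Fin 3) + 2 = 0 := rfl
  have e3 : (2 : Fin 3) + 1 = 0 := rfl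
  have e4 : (2 : Fin 3) + 2 = 1 := rfl
  simp only [e1, e2, e3, e4, zero_add]
  ring

end Curl

section Components

variable {F : V3 → ℝ → V3}

theorem contDiff_comps {n : WithTop ℕ∞} (hF : ContDiff ℝ n (fun p : V3 × ℝ => F p.1 p.2))
    (i : Fin 3) : ContDiff ℝ n (comps F i) :=
  contDiff_euclidean.1 hF i

theorem deriv_apply_eq_dirDeriv (hF : ContDiff ℝ 1 (fun p : V3 × ℝ => F p.1 p.2))
    (x : V3) (t : ℝ) (i : Fin 3) :
    deriv (F x) t i = dirDeriv timeDir (comps F i) (x, t) := by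
  have hd : DifferentiableAt ℝ (F x) t :=
    ((hF.comp (contDiff_const.prodMk contDiff_id : ContDiff ℝ 1 fun s : ℝ => (x, s))).differentiable
      (by norm_num)) t
  have h1 : HasDerivAt (fun s => F x s i) (deriv (F x) t i) t :=
    (EuclideanSpace.proj (𝕜 := ℝ) i).hasFDerivAt.comp_hasDerivAt t hd.hasDerivAt
  exact h1.unique (hasDerivAt_timeDir ((contDiff_comps hF i).differentiable (by norm_num) (x, t)))

theorem scurl_apply_eq_curlComp (hF : ContDiff ℝ 1 (fun p : V3 × ℝ => F p.1 p.2))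
    (x : V3) (t : ℝ) (i : Fin 3) :
    scurl (fun y => F y t) x i = curlComp (comps F) i (x, t) := by
  have key : ∀ j k, pd j (fun y => F y t k) x = dirDeriv (spaceDir j) (comps F k) (x, t) :=
    fun j k => fderiv_slice_apply_single
      ((contDiff_comps hF k).differentiable (by norm_num) (x, t)) j
  fin_cases i <;> simp [scurl, vec3, curlComp, key]

theorem comps_scurl (hF : ContDiff ℝ 1 (fun p : V3 × ℝ => F p.1 p.2)) :
    comps (fun x t => scurl (fun y => F y t) x) = curlComp (comps F) := by
  funext i p
  exact scurl_apply_eq_curlComp hF p.1 p.2 i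

theorem deriv_scurl_apply (hF : ContDiff ℝ 2 (fun p : V3 × ℝ => F p.1 p.2))
    (x : V3) (t : ℝ) (i : Fin 3) :
    deriv (fun s => scurl (fun y => F y s) x) t i
      = dirDeriv timeDir (curlComp (comps F) i) (x, t) := by
  have hF1 := hF.of_le (m := 1) (by norm_num)
  have hc : ContDiff ℝ 1 (fun p : V3 × ℝ => scurl (fun y => F y p.2) p.1) := by
    refine contDiff_euclidean.2 fun k => ?_
    simp only [scurl_apply_eq_curlComp hF1]
    exact contDiff_curlComp (contDiff_comps hF) k
  rw [← comps_scurl hF1]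
  exact deriv_apply_eq_dirDeriv (F := fun x s => scurl (fun y => F y s) x) hc x t i

end Components

section Maxwell

variable {e b P J : Fin 3 → V3 × ℝ → ℝ} {c T : ℝ}

/-- The inhomogeneous wave equation satisfied by the magnetic field. -/
theorem wave_equation (he : ∀ i, ContDiff ℝ 2 (e i)) (hb : ∀ i, ContDiff ℝ 2 (b i))
    (hP : ∀ i, ContDiff ℝ 2 (P i)) (hJ : ∀ i, ContDiff ℝ 1 (J i))
    (hAmp : ∀ x, ∀ t ∈ Set.Icc 0 T, ∀ i, dirDeriv timeDir (e i) (x, t)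
      = c * curlComp b i (x, t) - (4 * Real.pi) * dirDeriv timeDir (P i) (x, t)
        - (4 * Real.pi) * J i (x, t))
    (hFar : ∀ x, ∀ t ∈ Set.Icc 0 T, ∀ i,
      dirDeriv timeDir (b i) (x, t) = -c * curlComp e i (x, t))
    (x : V3) {t : ℝ} (ht : t ∈ Set.Ioo 0 T) (i : Fin 3) :
    dirDeriv timeDir (dirDeriv timeDir (b i)) (x, t)
      = -c ^ 2 * curlComp (curlComp b) i (x, t)
        + 4 * Real.pi * c * dirDeriv timeDir (curlComp P i) (x, t)
        + 4 * Real.pi * c * curlComp J i (x, t) := by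
  have hnhds : ∀ᶠ q : V3 × ℝ in nhds (x, t), q.2 ∈ Set.Icc 0 T :=
    (continuous_snd.tendsto (x, t)).eventually (Icc_mem_nhds ht.1 ht.2)
  have hdb : ∀ k, DifferentiableAt ℝ (curlComp b k) (x, t) := fun k =>
    (contDiff_curlComp hb k).differentiable (by norm_num) _
  have hde : ∀ k, DifferentiableAt ℝ (curlComp e k) (x, t) := fun k =>
    (contDiff_curlComp he k).differentiable (by norm_num) _
  have hdP : ∀ k, DifferentiableAt ℝ (dirDeriv timeDir (P k)) (x, t) := fun k =>
    (contDiff_dirDeriv (hP k) _).differentiable (by norm_num) _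
  have hdJ : ∀ k, DifferentiableAt ℝ (J k) (x, t) := fun k =>
    (hJ k).differentiable (by norm_num) _
  have hA : ∀ v k, dirDeriv v (dirDeriv timeDir (e k)) (x, t)
      = c * dirDeriv v (curlComp b k) (x, t)
        - (4 * Real.pi) * dirDeriv v (dirDeriv timeDir (P k)) (x, t)
        - (4 * Real.pi) * dirDeriv v (J k) (x, t) := by
    intro v k
    rw [dirDeriv_congr (hnhds.mono fun q hq => hAmp q.1 q.2 hq k),
      dirDeriv_sub (((hdb k).const_mul _).fun_sub ((hdP k).const_mul _)) ((hdJ k).const_mul _),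
      dirDeriv_sub ((hdb k).const_mul _) ((hdP k).const_mul _), dirDeriv_const_mul (hdb k),
      dirDeriv_const_mul (hdP k), dirDeriv_const_mul (hdJ k)]
  rw [dirDeriv_congr (hnhds.mono fun q hq => hFar q.1 q.2 hq i), dirDeriv_const_mul (hde i),
    dirDeriv_curlComp he, dirDeriv_curlComp hP]
  rw [curlComp, hA, hA, curlComp, curlComp, curlComp]
  ring

/-- The electromagnetic energy density built from `∂ₜB` and `curl B`. -/
def energyDensity (c : ℝ) (b : Fin 3 → V3 × ℝ → ℝ) (p : V3 × ℝ) : ℝ :=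
  ∑ i, dirDeriv timeDir (b i) p ^ 2 + c ^ 2 * ∑ i, curlComp b i p ^ 2

theorem contDiff_energyDensity (hb : ∀ i, ContDiff ℝ 2 (b i)) :
    ContDiff ℝ 1 (energyDensity c b) :=
  (ContDiff.sum fun i _ => (contDiff_dirDeriv (hb i) _).pow 2).add
    (contDiff_const.mul (ContDiff.sum fun i _ => (contDiff_curlComp hb i).pow 2))

theorem dirDeriv_energyDensity (hb : ∀ i, ContDiff ℝ 2 (b i)) (v p : V3 × ℝ) :
    dirDeriv v (energyDensity c b) p
      = 2 * ∑ i, dirDeriv timeDir (b i) p * dirDeriv v (dirDeriv timeDir (b i)) p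
        + 2 * c ^ 2 * ∑ i, curlComp b i p * dirDeriv v (curlComp b i) p := by
  have ha : ∀ k, DifferentiableAt ℝ (dirDeriv timeDir (b k)) p := fun k =>
    (contDiff_dirDeriv (hb k) _).differentiable (by norm_num) _
  have hc : ∀ k, DifferentiableAt ℝ (curlComp b k) p := fun k =>
    (contDiff_curlComp hb k).differentiable (by norm_num) _
  have h1 := fun k (_ : k ∈ Finset.univ) => (ha k).fun_mul (ha k)
  have h2 := fun k (_ : k ∈ Finset.univ) => (hc k).fun_mul (hc k)
  have hE : energyDensity c b = fun q =>
      (∑ i, dirDeriv timeDir (b i) q * dirDeriv timeDir (b i) q)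
        + c ^ 2 * ∑ i, curlComp b i q * curlComp b i q := by
    funext q
    simp only [energyDensity, sq]
  rw [hE, dirDeriv_add (DifferentiableAt.fun_sum h1) ((DifferentiableAt.fun_sum h2).const_mul _),
    dirDeriv_const_mul (DifferentiableAt.fun_sum h2), dirDeriv_sum h1, dirDeriv_sum h2]
  simp only [dirDeriv_mul (ha _) (ha _), dirDeriv_mul (hc _) (hc _), Fin.sum_univ_three]
  ring

/-- Local energy balance with flux `∂ₜB × curl B`. -/
theorem energy_balance (he : ∀ i, ContDiff ℝ 2 (e i)) (hb : ∀ i, ContDiff ℝ 2 (b i))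
    (hP : ∀ i, ContDiff ℝ 2 (P i)) (hJ : ∀ i, ContDiff ℝ 1 (J i))
    (hAmp : ∀ x, ∀ t ∈ Set.Icc 0 T, ∀ i, dirDeriv timeDir (e i) (x, t)
      = c * curlComp b i (x, t) - (4 * Real.pi) * dirDeriv timeDir (P i) (x, t)
        - (4 * Real.pi) * J i (x, t))
    (hFar : ∀ x, ∀ t ∈ Set.Icc 0 T, ∀ i,
      dirDeriv timeDir (b i) (x, t) = -c * curlComp e i (x, t))
    (x : V3) {t : ℝ} (ht : t ∈ Set.Ioo 0 T) :
    dirDeriv timeDir (energyDensity c b) (x, t)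
      = 8 * Real.pi * c * (∑ i, dirDeriv timeDir (b i) (x, t)
            * dirDeriv timeDir (curlComp P i) (x, t))
        + 8 * Real.pi * c * (∑ i, dirDeriv timeDir (b i) (x, t) * curlComp J i (x, t))
        + 2 * c ^ 2 * ∑ j, dirDeriv (spaceDir j)
            (fun q => dirDeriv timeDir (b (j + 1)) q * curlComp b (j + 2) q
              - dirDeriv timeDir (b (j + 2)) q * curlComp b (j + 1) q) (x, t) := by
  have ha : ∀ k, DifferentiableAt ℝ (dirDeriv timeDir (b k)) (x, t) := fun k =>
    (contDiff_dirDeriv (hb k) _).differentiable (by norm_num) _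
  have hc : ∀ k, DifferentiableAt ℝ (curlComp b k) (x, t) := fun k =>
    (contDiff_curlComp hb k).differentiable (by norm_num) _
  rw [sum_dirDeriv_cross (a := fun k => dirDeriv timeDir (b k)) ha hc, dirDeriv_energyDensity hb]
  simp only [wave_equation he hb hP hJ hAmp hFar x ht, dirDeriv_curlComp hb, Fin.sum_univ_three]
  ring

end Maxwell

section Integration

variable {K : Set V3} {T : ℝ}

theorem integral_dirDeriv_spaceDir_eq_zero (hK : IsCompact K) {f : V3 × ℝ → ℝ}
    (hf : ContDiff ℝ 1 f) {t : ℝ} (h0 : ∀ x ∉ K, f (x, t) = 0) (j : Fin 3) :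
    ∫ x in K, dirDeriv (spaceDir j) f (x, t) = 0 := by
  have hd : ∀ x, DifferentiableAt ℝ f (x, t) := fun x => hf.differentiable (by norm_num) _
  have hs : ContDiff ℝ 1 fun y => f (y, t) := hf.comp (contDiff_id.prodMk contDiff_const)
  have hsupp : HasCompactSupport fun y => f (y, t) := HasCompactSupport.intro hK h0
  have hsuppK : tsupport (fun y => f (y, t)) ⊆ K :=
    closure_minimal (fun x hx => by_contra fun hxK => hx (h0 x hxK)) hK.isClosed
  have hcont := hs.continuous_fderiv (by norm_num)
  have hdcont : Continuous fun x => fderiv ℝ (fun y => f (y, t)) x (EuclideanSpace.single j 1) :=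
    hcont.clm_apply continuous_const
  have hzero : ∀ x ∉ K, fderiv ℝ (fun y => f (y, t)) x (EuclideanSpace.single j 1) = 0 := by
    intro x hx
    rw [fderiv_of_notMem_tsupport ℝ (fun h => hx (hsuppK h))]
    rfl
  have hint : Integrable fun x => fderiv ℝ (fun y => f (y, t)) x (EuclideanSpace.single j 1) :=
    hdcont.integrable_of_hasCompactSupport (HasCompactSupport.intro hK hzero)
  simp only [← fderiv_slice_apply_single (hd _)]
  rw [setIntegral_eq_integral_of_forall_compl_eq_zero hzero]
  have := integral_mul_fderiv_eq_neg_fderiv_mul_of_integrable (μ := (volume : Measure V3))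
    (f := fun _ : V3 => (1 : ℝ)) (g := fun y => f (y, t)) (v := EuclideanSpace.single j 1)
    (by simp) (by simpa using hint)
    (by simpa using hs.continuous.integrable_of_hasCompactSupport hsupp)
    (fun x _ => differentiableAt_const _) (fun x _ => hs.differentiable (by norm_num) x)
  simpa using this

/-- A function vanishing outside `K` up to time `T` has vanishing derivative there. -/
theorem dirDeriv_eq_zero_of_notMem (hK : IsClosed K) (hT : 0 < T) {f : V3 × ℝ → ℝ}
    (hf : ContDiff ℝ 1 f) (h0 : ∀ x ∉ K, ∀ t ∈ Set.Icc 0 T, f (x, t) = 0)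
    (v : V3 × ℝ) {x : V3} (hx : x ∉ K) {t : ℝ} (ht : t ∈ Set.Icc 0 T) :
    dirDeriv v f (x, t) = 0 := by
  have hmem : ∀ s ∈ Set.Ioo 0 T, dirDeriv v f (x, s) = 0 := by
    intro s hs
    have : f =ᶠ[nhds (x, s)] fun _ => 0 := by
      filter_upwards [(hK.isOpen_compl.prod isOpen_Ioo).mem_nhds
        (show (x, s) ∈ Kᶜ ×ˢ Set.Ioo 0 T from ⟨hx, hs⟩)] with q hq
      exact h0 q.1 hq.1 q.2 (Set.Ioo_subset_Icc_self hq.2)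
    rw [dirDeriv_congr this]
    simp [dirDeriv]
  have hcl : IsClosed {s | dirDeriv v f (x, s) = 0} :=
    isClosed_eq ((continuous_dirDeriv hf v).comp (by fun_prop)) continuous_const
  have : closure (Set.Ioo 0 T) ⊆ {s | dirDeriv v f (x, s) = 0} := closure_minimal hmem hcl
  rw [closure_Ioo hT.ne] at this
  exact this ht

theorem setIntegral_sub_eq_intervalIntegral (hK : IsCompact K) (hT : 0 ≤ T) {u : V3 × ℝ → ℝ}
    (hu : ContDiff ℝ 1 u) :
    (∫ x in K, u (x, T)) - ∫ x in K, u (x, 0)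
      = ∫ t in (0 : ℝ)..T, ∫ x in K, dirDeriv timeDir u (x, t) := by
  have hc : Continuous (dirDeriv timeDir u) := continuous_dirDeriv hu _
  have hint : ∀ t : ℝ, IntegrableOn (fun x => u (x, t)) K := fun t =>
    (hu.continuous.comp (by fun_prop : Continuous fun x : V3 => (x, t))).continuousOn
      |>.integrableOn_compact hK
  rw [← integral_sub (hint T) (hint 0), intervalIntegral_integral_swap]
  · refine integral_congr_ae (Filter.Eventually.of_forall fun x => ?_)
    refine (intervalIntegral.integral_eq_sub_of_hasDerivAt
      (fun t _ => hasDerivAt_timeDir (hu.differentiable (by norm_num) (x, t))) ?_).symm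
    exact (hc.comp (by fun_prop : Continuous fun t : ℝ => (x, t))).intervalIntegrable _ _
  · rw [Measure.prod_restrict, ← Measure.volume_eq_prod]
    refine IntegrableOn.mono_set (t := Set.Icc 0 T ×ˢ K) ?_
      (Set.prod_mono (by rw [Set.uIoc_of_le hT]; exact Set.Ioc_subset_Icc_self) subset_rfl)
    exact (hc.comp (by fun_prop : Continuous fun q : ℝ × V3 => (q.2, q.1))).continuousOn
      |>.integrableOn_compact (isCompact_Icc.prod hK)

end Integration

theorem dtB_curlB_energy_identity (Ω : Set V3) (hΩo : IsOpen Ω) (hΩb : Bornology.IsBounded Ω)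
    (T : ℝ) (hT : 0 < T)
    (c : ℝ) (hc : 0 < c) (E B P J : V3 → ℝ → V3)
    (hE : ContDiff ℝ 2 (fun p : V3 × ℝ => E p.1 p.2)) (hB : ContDiff ℝ 2 (fun p : V3 × ℝ => B p.1 p.2))
    (hP : ContDiff ℝ 2 (fun p : V3 × ℝ => P p.1 p.2)) (hJ : ContDiff ℝ 2 (fun p : V3 × ℝ => J p.1 p.2))
    (hAmp : ∀ x : V3, ∀ t ∈ Set.Icc (0:ℝ) T,
      deriv (E x) t = c • scurl (fun y => B y t) x
        - (4*Real.pi) • deriv (P x) t - (4*Real.pi) • J x t)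
    (hFar : ∀ x : V3, ∀ t ∈ Set.Icc (0:ℝ) T,
      deriv (B x) t = -(c • scurl (fun y => E y t) x))
    (hBbc : DirichletBC Ω T B) :
    (∫ x in Ω, ‖deriv (B x) T‖^2) + c^2 * (∫ x in Ω, ‖scurl (fun y => B y T) x‖^2)
      = (∫ x in Ω, ‖deriv (B x) 0‖^2) + c^2 * (∫ x in Ω, ‖scurl (fun y => B y 0) x‖^2)
        + 8*Real.pi*c * (∫ t in (0:ℝ)..T, ∫ x in Ω,
            ⟪deriv (B x) t, deriv (fun s => scurl (fun y => P y s) x) t⟫)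
        + 8*Real.pi*c * (∫ t in (0:ℝ)..T, ∫ x in Ω,
            ⟪deriv (B x) t, scurl (fun y => J y t) x⟫) := by
  obtain ⟨K, hK, hKΩ, hBK⟩ := hBbc
  have hB1 := hB.of_le (m := 1) (by norm_num)
  have hJ1 := hJ.of_le (m := 1) (by norm_num)
  have he := contDiff_comps hE
  have hb := contDiff_comps hB
  have hP' := contDiff_comps hP
  have hJ' := contDiff_comps hJ1
  set e := comps E
  set b := comps B with hbdef
  have hAmp' : ∀ x, ∀ t ∈ Set.Icc 0 T, ∀ i, dirDeriv timeDir (e i) (x, t)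
      = c * curlComp b i (x, t) - (4 * Real.pi) * dirDeriv timeDir (comps P i) (x, t)
        - (4 * Real.pi) * comps J i (x, t) := by
    intro x t ht i
    have := congrArg (fun w : V3 => w i) (hAmp x t ht)
    simpa [deriv_apply_eq_dirDeriv (hE.of_le (m := 1) (by norm_num)),
      deriv_apply_eq_dirDeriv (hP.of_le (m := 1) (by norm_num)),
      scurl_apply_eq_curlComp hB1] using! this
  have hFar' : ∀ x, ∀ t ∈ Set.Icc 0 T, ∀ i,
      dirDeriv timeDir (b i) (x, t) = -c * curlComp e i (x, t) := by
    intro x t ht i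
    have := congrArg (fun w : V3 => w i) (hFar x t ht)
    simpa [deriv_apply_eq_dirDeriv hB1,
      scurl_apply_eq_curlComp (hE.of_le (m := 1) (by norm_num))] using this
  have hb0 : ∀ i, ∀ x ∉ K, ∀ t ∈ Set.Icc 0 T, b i (x, t) = 0 := by
    intro i x hx t ht
    have : B x t = 0 := by_contra fun h => hx (hBK t ht h)
    simp [hbdef, comps, this]
  have hD0 : ∀ v i, ∀ x ∉ K, ∀ t ∈ Set.Icc 0 T, dirDeriv v (b i) (x, t) = 0 :=
    fun v i x hx t ht => dirDeriv_eq_zero_of_notMem hK.isClosed hT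
      ((hb i).of_le (by norm_num)) (hb0 i) v hx ht
  have hdt : ∀ x t, ‖deriv (B x) t‖ ^ 2 = ∑ i, dirDeriv timeDir (b i) (x, t) ^ 2 := by
    intro x t
    simp [EuclideanSpace.norm_sq_eq, deriv_apply_eq_dirDeriv hB1, hbdef]
  have hcurl : ∀ x t, ‖scurl (fun y => B y t) x‖ ^ 2 = ∑ i, curlComp b i (x, t) ^ 2 := by
    intro x t
    simp [EuclideanSpace.norm_sq_eq, scurl_apply_eq_curlComp hB1, hbdef]
  have hinP : ∀ x t, ⟪deriv (B x) t, deriv (fun s => scurl (fun y => P y s) x) t⟫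
      = ∑ i, dirDeriv timeDir (b i) (x, t) * dirDeriv timeDir (curlComp (comps P) i) (x, t) := by
    intro x t
    simp [PiLp.inner_apply, deriv_apply_eq_dirDeriv hB1, deriv_scurl_apply hP, hbdef, mul_comm]
  have hinJ : ∀ x t, ⟪deriv (B x) t, scurl (fun y => J y t) x⟫
      = ∑ i, dirDeriv timeDir (b i) (x, t) * curlComp (comps J) i (x, t) := by
    intro x t
    simp [PiLp.inner_apply, deriv_apply_eq_dirDeriv hB1, scurl_apply_eq_curlComp hJ1, hbdef,
      mul_comm]
  simp only [hdt, hcurl, hinP, hinJ]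
  have hset : ∀ g : V3 → ℝ, (∀ x ∉ K, g x = 0) → ∫ x in Ω, g x = ∫ x in K, g x := fun g hg =>
    setIntegral_eq_of_subset_of_forall_sdiff_eq_zero hΩo.measurableSet hKΩ fun x hx => hg x hx.2
  have hslice : ∀ t : ℝ, Continuous fun x : V3 => (x, t) := fun t => by fun_prop
  have hcont_dt : ∀ i, Continuous (dirDeriv timeDir (b i)) := fun i =>
    (contDiff_dirDeriv (hb i) _).continuous
  have hcont_curl : ∀ i, Continuous (curlComp b i) := fun i => (contDiff_curlComp hb i).continuous
  have henergy : ∀ t ∈ Set.Icc 0 T, (∫ x in Ω, ∑ i, dirDeriv timeDir (b i) (x, t) ^ 2)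
      + c ^ 2 * (∫ x in Ω, ∑ i, curlComp b i (x, t) ^ 2)
      = ∫ x in K, energyDensity c b (x, t) := by
    intro t ht
    rw [hset _ fun x hx => by simp [hD0 _ _ x hx t ht],
      hset _ fun x hx => by simp [curlComp, hD0 _ _ x hx t ht], ← integral_const_mul,
      ← integral_add]
    · rfl
    · exact (Continuous.continuousOn (continuous_finsetSum _ fun i _ =>
        ((hcont_dt i).comp (hslice t)).pow 2)).integrableOn_compact hK
    · exact (Continuous.continuousOn (continuous_const.mul (continuous_finsetSum _ fun i _ =>
        ((hcont_curl i).comp (hslice t)).pow 2))).integrableOn_compact hK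
  have hsrcP : Continuous fun p => ∑ i, dirDeriv timeDir (b i) p
      * dirDeriv timeDir (curlComp (comps P) i) p := continuous_finsetSum _ fun i _ =>
    (hcont_dt i).mul (continuous_dirDeriv (contDiff_curlComp hP' i) _)
  have hsrcJ : Continuous fun p => ∑ i, dirDeriv timeDir (b i) p
      * curlComp (comps J) i p := continuous_finsetSum _ fun i _ =>
    (hcont_dt i).mul (continuous_curlComp hJ' i)
  have hparam : ∀ g : V3 × ℝ → ℝ, Continuous g →
      IntervalIntegrable (fun t => ∫ x in K, g (x, t)) volume 0 T := fun g hg =>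
    (continuous_parametric_integral_of_continuous (f := fun t x => g (x, t))
      (hg.comp continuous_swap) hK).intervalIntegrable _ _
  have hspace : ∀ g : V3 × ℝ → ℝ, Continuous g → ∀ t, IntegrableOn (fun x => g (x, t)) K :=
    fun g hg t => (hg.comp (hslice t)).continuousOn.integrableOn_compact hK
  have hrate : ∀ t ∈ Set.Ioo 0 T, ∫ x in K, dirDeriv timeDir (energyDensity c b) (x, t)
      = 8 * Real.pi * c * (∫ x in K, ∑ i, dirDeriv timeDir (b i) (x, t)
            * dirDeriv timeDir (curlComp (comps P) i) (x, t))
        + 8 * Real.pi * c * (∫ x in K, ∑ i, dirDeriv timeDir (b i) (x, t)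
            * curlComp (comps J) i (x, t)) := by
    intro t ht
    have hflux : ∀ j, ContDiff ℝ 1 (fun q => dirDeriv timeDir (b (j + 1)) q * curlComp b (j + 2) q
        - dirDeriv timeDir (b (j + 2)) q * curlComp b (j + 1) q) := fun j =>
      ((contDiff_dirDeriv (hb _) _).mul (contDiff_curlComp hb _)).sub
        ((contDiff_dirDeriv (hb _) _).mul (contDiff_curlComp hb _))
    have hfluxint := fun j : Fin 3 =>
      hspace _ (continuous_dirDeriv (hflux j) (spaceDir j)) t
    simp only [energy_balance he hb hP' hJ' hAmp' hFar' _ ht]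
    rw [integral_add (((hspace _ hsrcP t).const_mul _).fun_add ((hspace _ hsrcJ t).const_mul _))
        ((integrable_finsetSum _ fun j _ => hfluxint j).const_mul _),
      integral_add ((hspace _ hsrcP t).const_mul _) ((hspace _ hsrcJ t).const_mul _),
      integral_const_mul, integral_const_mul, integral_const_mul,
      integral_finsetSum _ fun j _ => hfluxint j]
    rw [Finset.sum_eq_zero fun j _ => integral_dirDeriv_spaceDir_eq_zero hK (hflux j)
      (fun x hx => by simp [hD0 _ _ x hx t (Set.Ioo_subset_Icc_self ht)]) j]
    ring
  have hsource : ∀ g : Fin 3 → V3 × ℝ → ℝ,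
      (∫ t in (0 : ℝ)..T, ∫ x in Ω, ∑ i, dirDeriv timeDir (b i) (x, t) * g i (x, t))
        = ∫ t in (0 : ℝ)..T, ∫ x in K, ∑ i, dirDeriv timeDir (b i) (x, t) * g i (x, t) := by
    intro g
    refine intervalIntegral.integral_congr fun t ht => ?_
    rw [Set.uIcc_of_le hT.le] at ht
    exact hset _ fun x hx => by simp [hD0 _ _ x hx t ht]
  have hbalance := setIntegral_sub_eq_intervalIntegral hK hT.le (contDiff_energyDensity (c := c) hb)
  rw [intervalIntegral.integral_congr_Ioo_of_le hT.le hrate,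
    intervalIntegral.integral_add ((hparam _ hsrcP).const_mul _) ((hparam _ hsrcJ).const_mul _),
    intervalIntegral.integral_const_mul, intervalIntegral.integral_const_mul] at hbalance
  rw [henergy T (Set.right_mem_Icc.2 hT.le), henergy 0 (Set.left_mem_Icc.2 hT.le),
    hsource, hsource]
  linarith
end
end

section
/- Let J, E be continuously differentiable ℝ³-valued fields and N_e a continuous real-valued field on ℝ³×[0,T] satisfying the Drude equation ∂ₜJ = −ν_e J + N_e E, with J and E satisfying the Dirichlet support condition. Then ‖J(·,T)‖²_{L²(Ω)} = ‖J(·,0)‖²_{L²(Ω)} − 2ν_e ∫₀ᵀ ‖J(·,t)‖²_{L²(Ω)} dt + 2∫₀ᵀ∫_Ω N_e(x,t) J(x,t)·E(x,t) dx dt. -/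
open MeasureTheory
open scoped RealInnerProductSpace

noncomputable section

/-- A continuous function on `V3 × ℝ` is integrable on a product of two bounded sets. -/
theorem Continuous.integrable_prod_restrict_of_isBounded {Ω : Set V3}
    (hΩ : Bornology.IsBounded Ω) (T : ℝ) {F : V3 × ℝ → ℝ} (hF : Continuous F) :
    Integrable F ((volume.restrict Ω).prod (volume.restrict (Set.Ioc 0 T))) := by
  rw [Measure.prod_restrict]
  have hK : IsCompact (closure Ω ×ˢ Set.Icc 0 T) := hΩ.isCompact_closure.prod isCompact_Icc
  exact (hF.continuousOn.integrableOn_compact hK).mono_set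
    (Set.prod_mono subset_closure Set.Ioc_subset_Icc_self)

/-- Fubini for a continuous function over a bounded set and a time interval. -/
theorem integral_intervalIntegral_comm {Ω : Set V3} (hΩ : Bornology.IsBounded Ω)
    {T : ℝ} (hT : 0 ≤ T) {F : V3 × ℝ → ℝ} (hF : Continuous F) :
    ∫ x in Ω, ∫ t in (0:ℝ)..T, F (x, t) = ∫ t in (0:ℝ)..T, ∫ x in Ω, F (x, t) := by
  simp only [intervalIntegral.integral_of_le hT]
  exact integral_integral_swap (hF.integrable_prod_restrict_of_isBounded hΩ T)

/-- The pointwise energy identity for the Drude equation, integrated in time. -/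
theorem norm_sq_sub_norm_sq_eq_intervalIntegral {T : ℝ} (hT : 0 ≤ T) {ν : ℝ}
    {j e : ℝ → V3} {n : ℝ → ℝ} (hj : Differentiable ℝ j) (he : Continuous e)
    (hn : Continuous n) (hD : ∀ t ∈ Set.Icc (0:ℝ) T, deriv j t = -(ν • j t) + n t • e t) :
    ‖j T‖ ^ 2 - ‖j 0‖ ^ 2
      = ∫ t in (0:ℝ)..T, (2 * (n t * ⟪j t, e t⟫) - 2 * ν * ‖j t‖ ^ 2) := by
  have hjc := hj.continuous
  refine (intervalIntegral.integral_eq_sub_of_hasDerivAt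
    (f := fun t => ‖j t‖ ^ 2) (fun t ht => ?_) ?_).symm
  · rw [Set.uIcc_of_le hT] at ht
    have h := (hj t).hasDerivAt.norm_sq
    rw [hD t ht] at h
    refine h.congr_deriv ?_
    simp only [inner_add_right, inner_neg_right, real_inner_smul_right,
      real_inner_self_eq_norm_sq]
    ring
  · exact Continuous.intervalIntegrable (by fun_prop) _ _

theorem drude_J_L2_identity (Ω : Set V3) (hΩo : IsOpen Ω) (hΩb : Bornology.IsBounded Ω)
    (T : ℝ) (hT : 0 < T)
    (νe : ℝ) (hνe : 0 ≤ νe) (J E : V3 → ℝ → V3) (Ne : V3 → ℝ → ℝ)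
    (hJ : ContDiff ℝ 1 (fun p : V3 × ℝ => J p.1 p.2)) (hE : ContDiff ℝ 1 (fun p : V3 × ℝ => E p.1 p.2))
    (hNe : Continuous (fun p : V3 × ℝ => Ne p.1 p.2))
    (hDrude : ∀ x : V3, ∀ t ∈ Set.Icc (0:ℝ) T,
      deriv (J x) t = -(νe • J x t) + Ne x t • E x t)
    (hJbc : DirichletBC Ω T J) (hEbc : DirichletBC Ω T E) :
    (∫ x in Ω, ‖J x T‖^2)
      = (∫ x in Ω, ‖J x 0‖^2)
        - 2*νe * (∫ t in (0:ℝ)..T, ∫ x in Ω, ‖J x t‖^2)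
        + 2 * (∫ t in (0:ℝ)..T, ∫ x in Ω, Ne x t * ⟪J x t, E x t⟫) := by
  have hJc : Continuous (fun p : V3 × ℝ => J p.1 p.2) := hJ.continuous
  have hEc : Continuous (fun p : V3 × ℝ => E p.1 p.2) := hE.continuous
  have hsq : Continuous (fun p : V3 × ℝ => ‖J p.1 p.2‖ ^ 2) := by fun_prop
  have hwork : Continuous (fun p : V3 × ℝ => Ne p.1 p.2 * ⟪J p.1 p.2, E p.1 p.2⟫) := by fun_prop
  have hpt (x : V3) : ‖J x T‖ ^ 2 - ‖J x 0‖ ^ 2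
      = ∫ t in (0:ℝ)..T, (2 * (Ne x t * ⟪J x t, E x t⟫) - 2 * νe * ‖J x t‖ ^ 2) :=
    norm_sq_sub_norm_sq_eq_intervalIntegral hT.le
      ((hJ.differentiable one_ne_zero).comp (by fun_prop : Differentiable ℝ fun t : ℝ => (x, t)))
      (hEc.comp (by fun_prop : Continuous fun t : ℝ => (x, t)))
      (hNe.comp (by fun_prop : Continuous fun t : ℝ => (x, t))) (hDrude x)
  have hslice (t : ℝ) : IntegrableOn (fun x => ‖J x t‖ ^ 2) Ω :=
    ((hsq.comp (by fun_prop : Continuous fun x : V3 => (x, t))).continuousOn.integrableOn_compact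
      hΩb.isCompact_closure).mono_set subset_closure
  have hsqI := hsq.integrable_prod_restrict_of_isBounded hΩb T
  have hworkI := hwork.integrable_prod_restrict_of_isBounded hΩb T
  have hsqT : IntervalIntegrable (fun t => ∫ x in Ω, ‖J x t‖ ^ 2) volume 0 T :=
    (intervalIntegrable_iff_integrableOn_Ioc_of_le hT.le).2 hsqI.integral_prod_right
  have hworkT : IntervalIntegrable (fun t => ∫ x in Ω, Ne x t * ⟪J x t, E x t⟫) volume 0 T :=
    (intervalIntegrable_iff_integrableOn_Ioc_of_le hT.le).2 hworkI.integral_prod_right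
  have hsplit (t : ℝ) : ∫ x in Ω, (2 * (Ne x t * ⟪J x t, E x t⟫) - 2 * νe * ‖J x t‖ ^ 2)
      = 2 * (∫ x in Ω, Ne x t * ⟪J x t, E x t⟫) - 2 * νe * ∫ x in Ω, ‖J x t‖ ^ 2 := by
    have hw : IntegrableOn (fun x => Ne x t * ⟪J x t, E x t⟫) Ω :=
      ((hwork.comp (by fun_prop : Continuous fun x : V3 => (x, t))).continuousOn.integrableOn_compact
        hΩb.isCompact_closure).mono_set subset_closure
    rw [integral_sub (hw.const_mul 2) ((hslice t).const_mul (2 * νe)), integral_const_mul,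
      integral_const_mul]
  have key := integral_sub (hslice T) (hslice 0)
  simp only [hpt] at key
  rw [integral_intervalIntegral_comm hΩb hT.le
    (F := fun p => 2 * (Ne p.1 p.2 * ⟪J p.1 p.2, E p.1 p.2⟫) - 2 * νe * ‖J p.1 p.2‖ ^ 2)
    (by fun_prop)] at key
  simp only [hsplit] at key
  rw [intervalIntegral.integral_sub (hworkT.const_mul 2) (hsqT.const_mul (2 * νe)),
    intervalIntegral.integral_const_mul, intervalIntegral.integral_const_mul] at key
  linarith
end
end

section
/- Let J, E be twice continuously differentiable ℝ³-valued fields and N_e a continuously differentiable real-valued field on ℝ³×[0,T] satisfying the Drude equation ∂ₜJ = −ν_e J + N_e E, with J and E satisfying the Dirichlet support condition. Then ‖∂ₜJ(·,T)‖²_{L²(Ω)} = ‖∂ₜJ(·,0)‖²_{L²(Ω)} − 2ν_e ∫₀ᵀ ‖∂ₜJ(·,t)‖²_{L²(Ω)} dt + 2∫₀ᵀ∫_Ω N_e(x,t) ∂ₜJ(x,t)·∂ₜE(x,t) dx dt + 2∫₀ᵀ∫_Ω ∂ₜN_e(x,t) ∂ₜJ(x,t)·E(x,t) dx dt. -/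
open MeasureTheory
open scoped RealInnerProductSpace

noncomputable section

section ParametricDeriv

variable {X W : Type*} [NormedAddCommGroup X] [NormedSpace ℝ X]
  [NormedAddCommGroup W] [NormedSpace ℝ W]

/-- The partial time derivative of a jointly differentiable field, as a total derivative. -/
theorem hasDerivAt_fderiv_of_differentiable {F : X → ℝ → W}
    (hF : Differentiable ℝ (fun p : X × ℝ => F p.1 p.2)) (x : X) (t : ℝ) :
    HasDerivAt (F x) (fderiv ℝ (fun p : X × ℝ => F p.1 p.2) (x, t) (0, 1)) t :=
  (hF (x, t)).hasFDerivAt.comp_hasDerivAt (f := fun s : ℝ => (x, s)) t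
    ((hasDerivAt_const t x).prodMk (hasDerivAt_id t))

theorem hasDerivAt_deriv_of_differentiable {F : X → ℝ → W}
    (hF : Differentiable ℝ (fun p : X × ℝ => F p.1 p.2)) (x : X) (t : ℝ) :
    HasDerivAt (F x) (deriv (F x) t) t :=
  (hasDerivAt_fderiv_of_differentiable hF x t).differentiableAt.hasDerivAt

theorem contDiff_deriv_snd {F : X → ℝ → W} {m n : WithTop ℕ∞}
    (hF : ContDiff ℝ n (fun p : X × ℝ => F p.1 p.2)) (hmn : m + 1 ≤ n) :
    ContDiff ℝ m (fun p : X × ℝ => deriv (F p.1) p.2) := by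
  have hn : n ≠ 0 := by
    rintro rfl
    simp at hmn
  have h : (fun p : X × ℝ => deriv (F p.1) p.2)
      = fun p => fderiv ℝ (fun p : X × ℝ => F p.1 p.2) p (0, 1) := by
    funext p
    exact (hasDerivAt_fderiv_of_differentiable (hF.differentiable hn) p.1 p.2).deriv
  rw [h]
  exact (hF.fderiv_right hmn).clm_apply contDiff_const

end ParametricDeriv

section SpaceTimeIntegral

variable {X : Type*} [MetricSpace X] [ProperSpace X]
  [MeasurableSpace X] [BorelSpace X] {μ : Measure X} [IsFiniteMeasureOnCompacts μ]
  {Ω : Set X} {f : X × ℝ → ℝ}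

theorem Continuous.integrableOn_of_isBounded {g : X → ℝ} (hg : Continuous g)
    (hΩ : Bornology.IsBounded Ω) : IntegrableOn g Ω μ :=
  (hg.continuousOn.integrableOn_compact hΩ.isCompact_closure).mono_set subset_closure

variable [SFinite μ]

theorem integrable_prod_restrict_Ioc_of_continuous (hf : Continuous f)
    (hΩ : Bornology.IsBounded Ω) (a b : ℝ) :
    Integrable f ((μ.restrict Ω).prod (volume.restrict (Set.Ioc a b))) := by
  rw [Measure.prod_restrict]
  exact (hf.continuousOn.integrableOn_compact (hΩ.isCompact_closure.prod isCompact_Icc)).mono_set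
    (Set.prod_mono subset_closure Set.Ioc_subset_Icc_self)

theorem intervalIntegral_setIntegral_eq_integral_prod (hf : Continuous f)
    (hΩ : Bornology.IsBounded Ω) {a b : ℝ} (hab : a ≤ b) :
    ∫ t in a..b, ∫ x in Ω, f (x, t) ∂μ
      = ∫ p, f p ∂((μ.restrict Ω).prod (volume.restrict (Set.Ioc a b))) := by
  rw [intervalIntegral.integral_of_le hab,
    integral_prod_symm _ (integrable_prod_restrict_Ioc_of_continuous hf hΩ a b)]

theorem setIntegral_intervalIntegral_eq_integral_prod (hf : Continuous f)
    (hΩ : Bornology.IsBounded Ω) {a b : ℝ} (hab : a ≤ b) :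
    ∫ x in Ω, (∫ t in a..b, f (x, t)) ∂μ
      = ∫ p, f p ∂((μ.restrict Ω).prod (volume.restrict (Set.Ioc a b))) := by
  simp_rw [intervalIntegral.integral_of_le hab]
  rw [integral_prod _ (integrable_prod_restrict_Ioc_of_continuous hf hΩ a b)]

end SpaceTimeIntegral

/-- Differentiating the Drude equation in time and pairing with the derivative of `j`. -/
theorem hasDerivAt_norm_sq_deriv_of_drude {W : Type*} [NormedAddCommGroup W]
    [InnerProductSpace ℝ W] {j e : ℝ → W} {n : ℝ → ℝ} {ν t : ℝ}
    (hj : DifferentiableAt ℝ j t) (he : DifferentiableAt ℝ e t) (hn : DifferentiableAt ℝ n t)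
    (hD : ∀ᶠ s in nhds t, deriv j s = -(ν • j s) + n s • e s) :
    HasDerivAt (fun s => ‖deriv j s‖ ^ 2)
      (-(2 * ν) * ‖deriv j t‖ ^ 2 + 2 * (n t * ⟪deriv j t, deriv e t⟫)
        + 2 * (deriv n t * ⟪deriv j t, e t⟫)) t := by
  have h : HasDerivAt (deriv j)
      (-(ν • deriv j t) + (n t • deriv e t + deriv n t • e t)) t :=
    ((hj.hasDerivAt.const_smul ν).neg.add
      (hn.hasDerivAt.smul he.hasDerivAt)).congr_of_eventuallyEq hD
  convert h.norm_sq using 1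
  simp only [inner_add_right, inner_neg_right, real_inner_smul_right, real_inner_self_eq_norm_sq]
  ring

theorem drude_dtJ_L2_identity (Ω : Set V3) (hΩo : IsOpen Ω) (hΩb : Bornology.IsBounded Ω)
    (T : ℝ) (hT : 0 < T)
    (νe : ℝ) (hνe : 0 ≤ νe) (J E : V3 → ℝ → V3) (Ne : V3 → ℝ → ℝ)
    (hJ : ContDiff ℝ 2 (fun p : V3 × ℝ => J p.1 p.2)) (hE : ContDiff ℝ 2 (fun p : V3 × ℝ => E p.1 p.2))
    (hNe : ContDiff ℝ 1 (fun p : V3 × ℝ => Ne p.1 p.2))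
    (hDrude : ∀ x : V3, ∀ t ∈ Set.Icc (0:ℝ) T,
      deriv (J x) t = -(νe • J x t) + Ne x t • E x t)
    (hJbc : DirichletBC Ω T J) (hEbc : DirichletBC Ω T E) :
    (∫ x in Ω, ‖deriv (J x) T‖^2)
      = (∫ x in Ω, ‖deriv (J x) 0‖^2)
        - 2*νe * (∫ t in (0:ℝ)..T, ∫ x in Ω, ‖deriv (J x) t‖^2)
        + 2 * (∫ t in (0:ℝ)..T, ∫ x in Ω, Ne x t * ⟪deriv (J x) t, deriv (E x) t⟫)
        + 2 * (∫ t in (0:ℝ)..T, ∫ x in Ω, deriv (Ne x) t * ⟪deriv (J x) t, E x t⟫) := by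
  have hJd := hJ.differentiable (by norm_num)
  have hEd := hE.differentiable (by norm_num)
  have hNd := hNe.differentiable (by norm_num)
  have hJt : Continuous fun p : V3 × ℝ => deriv (J p.1) p.2 :=
    (contDiff_deriv_snd (m := 1) hJ (by norm_num)).continuous
  have hEt : Continuous fun p : V3 × ℝ => deriv (E p.1) p.2 :=
    (contDiff_deriv_snd (m := 1) hE (by norm_num)).continuous
  have hNt : Continuous fun p : V3 × ℝ => deriv (Ne p.1) p.2 :=
    (contDiff_deriv_snd (m := 0) hNe (by norm_num)).continuous
  have hA : Continuous fun p : V3 × ℝ => ‖deriv (J p.1) p.2‖ ^ 2 := hJt.norm.pow 2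
  have hB : Continuous fun p : V3 × ℝ => Ne p.1 p.2 * ⟪deriv (J p.1) p.2, deriv (E p.1) p.2⟫ :=
    hNe.continuous.mul (hJt.inner hEt)
  have hC : Continuous fun p : V3 × ℝ => deriv (Ne p.1) p.2 * ⟪deriv (J p.1) p.2, E p.1 p.2⟫ :=
    hNt.mul (hJt.inner hE.continuous)
  have hG : Continuous fun p : V3 × ℝ => -(2 * νe) * ‖deriv (J p.1) p.2‖ ^ 2
      + 2 * (Ne p.1 p.2 * ⟪deriv (J p.1) p.2, deriv (E p.1) p.2⟫)
      + 2 * (deriv (Ne p.1) p.2 * ⟪deriv (J p.1) p.2, E p.1 p.2⟫) :=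
    ((hA.const_mul (-(2 * νe))).add (hB.const_mul 2)).add (hC.const_mul 2)
  have hftc : ∀ x, ∫ t in (0:ℝ)..T, (-(2 * νe) * ‖deriv (J x) t‖ ^ 2
        + 2 * (Ne x t * ⟪deriv (J x) t, deriv (E x) t⟫)
        + 2 * (deriv (Ne x) t * ⟪deriv (J x) t, E x t⟫))
      = ‖deriv (J x) T‖ ^ 2 - ‖deriv (J x) 0‖ ^ 2 := by
    intro x
    refine intervalIntegral.integral_eq_sub_of_hasDerivAt_of_le hT.le
      (hA.comp (Continuous.prodMk_right x)).continuousOn (fun t ht => ?_)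
      ((hG.comp (Continuous.prodMk_right x)).intervalIntegrable 0 T)
    refine hasDerivAt_norm_sq_deriv_of_drude
      (hasDerivAt_deriv_of_differentiable hJd x t).differentiableAt
      (hasDerivAt_deriv_of_differentiable hEd x t).differentiableAt
      (hasDerivAt_deriv_of_differentiable hNd x t).differentiableAt ?_
    filter_upwards [Icc_mem_nhds ht.1 ht.2] with s hs using hDrude x s hs
  have hint : ∀ t, IntegrableOn (fun x => ‖deriv (J x) t‖ ^ 2) Ω volume := fun t =>
    (hA.comp (Continuous.prodMk_left t)).integrableOn_of_isBounded hΩb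
  have hdiff := integral_sub (hint T) (hint 0)
  simp_rw [← hftc] at hdiff
  have iA := integrable_prod_restrict_Ioc_of_continuous (μ := volume) hA hΩb 0 T
  have iB := integrable_prod_restrict_Ioc_of_continuous (μ := volume) hB hΩb 0 T
  have iC := integrable_prod_restrict_Ioc_of_continuous (μ := volume) hC hΩb 0 T
  have hsum := setIntegral_intervalIntegral_eq_integral_prod (μ := volume) hG hΩb hT.le
  have iAB := integrable_prod_restrict_Ioc_of_continuous (μ := volume)
    (f := fun p : V3 × ℝ => -(2 * νe) * ‖deriv (J p.1) p.2‖ ^ 2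
      + 2 * (Ne p.1 p.2 * ⟪deriv (J p.1) p.2, deriv (E p.1) p.2⟫))
    ((hA.const_mul _).add (hB.const_mul _)) hΩb 0 T
  rw [integral_add iAB (iC.const_mul _),
    integral_add (iA.const_mul _) (iB.const_mul _)] at hsum
  simp only [integral_const_mul] at hsum
  rw [← intervalIntegral_setIntegral_eq_integral_prod hA hΩb hT.le,
    ← intervalIntegral_setIntegral_eq_integral_prod hB hΩb hT.le,
    ← intervalIntegral_setIntegral_eq_integral_prod hC hΩb hT.le] at hsum
  linarith [hdiff.symm.trans hsum]
end
end

section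
/- Let J, E be twice continuously differentiable ℝ³-valued fields and N_e a continuously differentiable real-valued field on ℝ³×[0,T] satisfying the Drude equation ∂ₜJ = −ν_e J + N_e E, with J and E satisfying the Dirichlet support condition. Then ‖∇×J(·,T)‖²_{L²(Ω)} = ‖∇×J(·,0)‖²_{L²(Ω)} − 2ν_e ∫₀ᵀ ‖∇×J(·,t)‖²_{L²(Ω)} dt + 2∫₀ᵀ∫_Ω (∇N_e(x,t)×E(x,t))·(∇×J)(x,t) dx dt + 2∫₀ᵀ∫_Ω N_e(x,t) (∇×E)(x,t)·(∇×J)(x,t) dx dt. -/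
open MeasureTheory
open scoped RealInnerProductSpace

noncomputable section

@[simp] lemma vec3_apply_zero (a b c : ℝ) : vec3 a b c 0 = a := rfl

@[simp] lemma vec3_apply_one (a b c : ℝ) : vec3 a b c 1 = b := rfl

@[simp] lemma vec3_apply_two (a b c : ℝ) : vec3 a b c 2 = c := rfl

@[simp] lemma sgrad_apply (g : V3 → ℝ) (x : V3) (i : Fin 3) : sgrad g x i = pd i g x := rfl

section PartialDerivatives

lemma pd_neg (i : Fin 3) (f : V3 → ℝ) (x : V3) : pd i (fun y => -f y) x = -pd i f x := by
  simp [pd, fderiv_fun_neg]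

lemma pd_add (i : Fin 3) {f g : V3 → ℝ} {x : V3} (hf : DifferentiableAt ℝ f x)
    (hg : DifferentiableAt ℝ g x) : pd i (fun y => f y + g y) x = pd i f x + pd i g x := by
  simp [pd, fderiv_fun_add hf hg]

lemma pd_const_mul (i : Fin 3) (c : ℝ) {f : V3 → ℝ} {x : V3} (hf : DifferentiableAt ℝ f x) :
    pd i (fun y => c * f y) x = c * pd i f x := by
  simp [pd, fderiv_const_mul hf]

lemma pd_mul (i : Fin 3) {f g : V3 → ℝ} {x : V3} (hf : DifferentiableAt ℝ f x)
    (hg : DifferentiableAt ℝ g x) :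
    pd i (fun y => f y * g y) x = f x * pd i g x + pd i f x * g x := by
  simp [pd, fderiv_fun_mul hf hg, mul_comm]

/-- The spatial partial derivative of a space-time function is a directional derivative of its
total derivative. -/
lemma pd_eq_fderiv_prod (i : Fin 3) {G : V3 × ℝ → ℝ} {x : V3} {t : ℝ}
    (hG : DifferentiableAt ℝ G (x, t)) :
    pd i (fun y => G (y, t)) x = fderiv ℝ G (x, t) (EuclideanSpace.single i 1, 0) := by
  have h : HasFDerivAt (fun y => G (y, t)) _ x :=
    hG.hasFDerivAt.comp x (hasFDerivAt_prodMk_left x t)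
  simp [pd, h.fderiv]

lemma continuous_pd (i : Fin 3) {G : V3 × ℝ → ℝ} (hG : ContDiff ℝ 1 G) :
    Continuous fun p : V3 × ℝ => pd i (fun y => G (y, p.2)) p.1 := by
  have h (p : V3 × ℝ) : pd i (fun y => G (y, p.2)) p.1
      = fderiv ℝ G p (EuclideanSpace.single i 1, 0) :=
    pd_eq_fderiv_prod i (hG.differentiable one_ne_zero _)
  simp_rw [h]
  exact (hG.continuous_fderiv one_ne_zero).clm_apply continuous_const

/-- Time and space derivatives of a twice continuously differentiable function commute. -/
lemma hasDerivAt_pd (i : Fin 3) {G : V3 × ℝ → ℝ} (hG : ContDiff ℝ 2 G) (x : V3) (t : ℝ) :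
    HasDerivAt (fun s => pd i (fun y => G (y, s)) x)
      (pd i (fun y => deriv (fun s => G (y, s)) t) x) t := by
  have hd : Differentiable ℝ G := hG.differentiable two_ne_zero
  have hd' : Differentiable ℝ (fderiv ℝ G) :=
    (hG.fderiv_right (m := 1) le_rfl).differentiable one_ne_zero
  have hpd (s : ℝ) := pd_eq_fderiv_prod i (hd (x, s))
  have hdt (y : V3) : deriv (fun s => G (y, s)) t = fderiv ℝ G (y, t) (0, 1) := by
    have h := ((hd (y, t)).hasFDerivAt.comp t (hasFDerivAt_prodMk_right y t)).hasDerivAt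
    simpa [Function.comp_def] using h.deriv
  simp_rw [hpd, hdt]
  have hd₀ : Differentiable ℝ fun p => fderiv ℝ G p (0, 1) :=
    hd'.clm_apply (differentiable_const _)
  rw [pd_eq_fderiv_prod i (hd₀ (x, t)),
    fderiv_clm_apply (hd' _) (differentiableAt_const _)]
  have h := ((((hd' (x, t)).hasFDerivAt.comp t (hasFDerivAt_prodMk_right x t)).hasDerivAt).clm_apply
    (hasDerivAt_const t ((EuclideanSpace.single i 1, 0) : V3 × ℝ)))
  have hsymm := hG.contDiffAt.isSymmSndFDerivAt (x := (x, t)) (by simp)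
  simpa [hsymm.eq (EuclideanSpace.single i 1, 0) (0, 1)] using h

end PartialDerivatives

section Curl

lemma continuous_vec3 {X : Type*} [TopologicalSpace X] {a b c : X → ℝ} (ha : Continuous a)
    (hb : Continuous b) (hc : Continuous c) : Continuous fun x => vec3 (a x) (b x) (c x) := by
  refine (PiLp.continuous_toLp 2 _).comp (continuous_pi fun i => ?_)
  fin_cases i <;> assumption

lemma hasDerivAt_vec3 {a b c : ℝ → ℝ} {a' b' c' t : ℝ} (ha : HasDerivAt a a' t)
    (hb : HasDerivAt b b' t) (hc : HasDerivAt c c' t) :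
    HasDerivAt (fun s => vec3 (a s) (b s) (c s)) (vec3 a' b' c') t := by
  rw [hasDerivAt_iff_hasFDerivAt, ← hasFDerivWithinAt_univ, hasFDerivWithinAt_euclidean]
  intro i
  rw [hasFDerivWithinAt_univ, hasFDerivAt_iff_hasDerivAt]
  fin_cases i <;> simpa

lemma continuous_scurl {F : V3 → ℝ → V3} (hF : ContDiff ℝ 1 fun p : V3 × ℝ => F p.1 p.2) :
    Continuous fun p : V3 × ℝ => scurl (fun y => F y p.2) p.1 := by
  have h (i j : Fin 3) := continuous_pd i (contDiff_euclidean.1 hF j)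
  exact continuous_vec3 ((h 1 2).sub (h 2 1)) ((h 2 0).sub (h 0 2)) ((h 0 1).sub (h 1 0))

lemma continuous_sgrad {g : V3 → ℝ → ℝ} (hg : ContDiff ℝ 1 fun p : V3 × ℝ => g p.1 p.2) :
    Continuous fun p : V3 × ℝ => sgrad (fun y => g y p.2) p.1 :=
  (PiLp.continuous_toLp 2 _).comp (continuous_pi fun i => continuous_pd i hg)

lemma continuous_cross3 {X : Type*} [TopologicalSpace X] {a b : X → V3} (ha : Continuous a)
    (hb : Continuous b) : Continuous fun x => cross3 (a x) (b x) := by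
  unfold cross3
  apply continuous_vec3 <;> fun_prop

/-- Curl and time derivative of a twice continuously differentiable field commute. -/
lemma hasDerivAt_scurl {F : V3 → ℝ → V3} (hF : ContDiff ℝ 2 fun p : V3 × ℝ => F p.1 p.2)
    (x : V3) (t : ℝ) :
    HasDerivAt (fun s => scurl (fun y => F y s) x) (scurl (fun y => deriv (F y) t) x) t := by
  have hcoord (y : V3) (j : Fin 3) : deriv (F y) t j = deriv (fun s => F y s j) t := by
    have h : HasDerivAt (F y) (deriv (F y) t) t :=
      ((hF.differentiable two_ne_zero).comp
        (differentiable_const y |>.prodMk differentiable_id)).differentiableAt.hasDerivAt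
    exact ((EuclideanSpace.proj (𝕜 := ℝ) j).hasFDerivAt.comp_hasDerivAt t h).deriv.symm
  have h (i j : Fin 3) := hasDerivAt_pd i (contDiff_euclidean.1 hF j) x t
  simp only [scurl, hcoord]
  exact hasDerivAt_vec3 ((h 1 2).sub (h 2 1)) ((h 2 0).sub (h 0 2)) ((h 0 1).sub (h 1 0))

/-- The curl of the right-hand side of the Drude equation. -/
lemma scurl_neg_smul_add_smul (c : ℝ) {A B : V3 → V3} {g : V3 → ℝ} {x : V3}
    (hA : DifferentiableAt ℝ A x) (hB : DifferentiableAt ℝ B x) (hg : DifferentiableAt ℝ g x) :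
    scurl (fun y => -(c • A y) + g y • B y) x
      = -(c • scurl A x) + (cross3 (sgrad g x) (B x) + g x • scurl B x) := by
  have hA' (j : Fin 3) : DifferentiableAt ℝ (fun y => A y j) x := differentiableAt_euclidean.1 hA j
  have hB' (j : Fin 3) : DifferentiableAt ℝ (fun y => B y j) x := differentiableAt_euclidean.1 hB j
  have h (i j : Fin 3) : pd i (fun y => (-(c • A y) + g y • B y) j) x
      = -(c * pd i (fun y => A y j) x)
        + (g x * pd i (fun y => B y j) x + pd i g x * B x j) := by
    simp only [PiLp.add_apply, PiLp.neg_apply, PiLp.smul_apply, smul_eq_mul]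
    rw [pd_add i ((hA' j).const_mul c).fun_neg (hg.fun_mul (hB' j)), pd_neg,
      pd_const_mul i c (hA' j), pd_mul i hg (hB' j)]
  ext k
  simp only [scurl, h]
  fin_cases k <;> simp [cross3] <;> ring

end Curl

section SpaceTimeIntegrals

variable {Ω : Set V3} {f : V3 → ℝ → ℝ}

lemma integrableOn_of_continuous_of_isBounded (hΩ : Bornology.IsBounded Ω) {g : V3 → ℝ}
    (hg : Continuous g) : IntegrableOn g Ω :=
  (hg.continuousOn.integrableOn_compact hΩ.isCompact_closure).mono_set subset_closure

lemma integrable_prod_of_continuous_of_isBounded (hΩ : Bornology.IsBounded Ω)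
    (hf : Continuous fun p : V3 × ℝ => f p.1 p.2) (a b : ℝ) :
    Integrable (Function.uncurry fun t x => f x t)
      ((volume.restrict (Set.uIoc a b)).prod (volume.restrict Ω)) := by
  rw [Measure.prod_restrict]
  have hc : Continuous (Function.uncurry fun t x => f x t) := hf.comp continuous_swap
  exact (hc.continuousOn.integrableOn_compact
    (isCompact_uIcc.prod hΩ.isCompact_closure)).mono_set
    (Set.prod_mono Set.uIoc_subset_uIcc subset_closure)

lemma intervalIntegrable_setIntegral (hΩ : Bornology.IsBounded Ω)
    (hf : Continuous fun p : V3 × ℝ => f p.1 p.2) (a b : ℝ) :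
    IntervalIntegrable (fun t => ∫ x in Ω, f x t) volume a b :=
  intervalIntegrable_iff.2
    (integrable_prod_of_continuous_of_isBounded hΩ hf a b).integral_prod_left

/-- Integrating the time derivative over space-time gives the difference of the spatial
integrals at the end points. -/
lemma intervalIntegral_setIntegral_deriv (hΩ : Bornology.IsBounded Ω) {f' : V3 → ℝ → ℝ} {a b : ℝ}
    (hf : Continuous fun p : V3 × ℝ => f p.1 p.2) (hf' : Continuous fun p : V3 × ℝ => f' p.1 p.2)
    (hderiv : ∀ x, ∀ t ∈ Set.uIcc a b, HasDerivAt (f x) (f' x t) t) :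
    ∫ t in a..b, ∫ x in Ω, f' x t = (∫ x in Ω, f x b) - ∫ x in Ω, f x a := by
  have hslice (t : ℝ) : IntegrableOn (fun x => f x t) Ω :=
    integrableOn_of_continuous_of_isBounded hΩ
      (hf.comp (continuous_id.prodMk continuous_const))
  rw [intervalIntegral_integral_swap (integrable_prod_of_continuous_of_isBounded hΩ hf' a b),
    ← integral_sub (hslice b) (hslice a)]
  congr 1 with x
  exact intervalIntegral.integral_eq_sub_of_hasDerivAt (hderiv x)
    ((hf'.comp (continuous_const.prodMk continuous_id)).intervalIntegrable a b)

lemma intervalIntegral_setIntegral_linearCombination (hΩ : Bornology.IsBounded Ω)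
    {g h : V3 → ℝ → ℝ} (hf : Continuous fun p : V3 × ℝ => f p.1 p.2)
    (hg : Continuous fun p : V3 × ℝ => g p.1 p.2) (hh : Continuous fun p : V3 × ℝ => h p.1 p.2)
    (α β γ a b : ℝ) :
    ∫ t in a..b, ∫ x in Ω, (α * f x t + β * g x t + γ * h x t)
      = α * (∫ t in a..b, ∫ x in Ω, f x t) + β * (∫ t in a..b, ∫ x in Ω, g x t)
        + γ * ∫ t in a..b, ∫ x in Ω, h x t := by
  have hslice (t : ℝ) : Continuous fun x : V3 => (x, t) := continuous_id.prodMk continuous_const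
  have hspace (t : ℝ) : ∫ x in Ω, (α * f x t + β * g x t + γ * h x t)
      = α * (∫ x in Ω, f x t) + β * (∫ x in Ω, g x t) + γ * ∫ x in Ω, h x t := by
    have iF : IntegrableOn (fun x => α * f x t) Ω :=
      (integrableOn_of_continuous_of_isBounded hΩ (hf.comp (hslice t))).const_mul α
    have iG : IntegrableOn (fun x => β * g x t) Ω :=
      (integrableOn_of_continuous_of_isBounded hΩ (hg.comp (hslice t))).const_mul β
    have iH : IntegrableOn (fun x => γ * h x t) Ω :=
      (integrableOn_of_continuous_of_isBounded hΩ (hh.comp (hslice t))).const_mul γ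
    have iFG : IntegrableOn (fun x => α * f x t + β * g x t) Ω := iF.add iG
    rw [integral_add iFG iH, integral_add iF iG, integral_const_mul, integral_const_mul,
      integral_const_mul]
  have jF := (intervalIntegrable_setIntegral hΩ hf a b).const_mul α
  have jG := (intervalIntegrable_setIntegral hΩ hg a b).const_mul β
  have jH := (intervalIntegrable_setIntegral hΩ hh a b).const_mul γ
  have jFG : IntervalIntegrable
      (fun t => α * (∫ x in Ω, f x t) + β * ∫ x in Ω, g x t) volume a b := jF.add jG
  simp_rw [hspace]
  rw [intervalIntegral.integral_add jFG jH, intervalIntegral.integral_add jF jG,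
    intervalIntegral.integral_const_mul, intervalIntegral.integral_const_mul,
    intervalIntegral.integral_const_mul]

end SpaceTimeIntegrals

theorem drude_curlJ_L2_identity (Ω : Set V3) (hΩo : IsOpen Ω) (hΩb : Bornology.IsBounded Ω)
    (T : ℝ) (hT : 0 < T)
    (νe : ℝ) (hνe : 0 ≤ νe) (J E : V3 → ℝ → V3) (Ne : V3 → ℝ → ℝ)
    (hJ : ContDiff ℝ 2 (fun p : V3 × ℝ => J p.1 p.2)) (hE : ContDiff ℝ 2 (fun p : V3 × ℝ => E p.1 p.2))
    (hNe : ContDiff ℝ 1 (fun p : V3 × ℝ => Ne p.1 p.2))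
    (hDrude : ∀ x : V3, ∀ t ∈ Set.Icc (0:ℝ) T,
      deriv (J x) t = -(νe • J x t) + Ne x t • E x t)
    (hJbc : DirichletBC Ω T J) (hEbc : DirichletBC Ω T E) :
    (∫ x in Ω, ‖scurl (fun y => J y T) x‖^2)
      = (∫ x in Ω, ‖scurl (fun y => J y 0) x‖^2)
        - 2*νe * (∫ t in (0:ℝ)..T, ∫ x in Ω, ‖scurl (fun y => J y t) x‖^2)
        + 2 * (∫ t in (0:ℝ)..T, ∫ x in Ω,
            ⟪cross3 (sgrad (fun y => Ne y t) x) (E x t), scurl (fun y => J y t) x⟫)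
        + 2 * (∫ t in (0:ℝ)..T, ∫ x in Ω,
            Ne x t * ⟪scurl (fun y => E y t) x, scurl (fun y => J y t) x⟫) := by
  have hCJ := continuous_scurl (hJ.of_le one_le_two)
  have hCE := continuous_scurl (hE.of_le one_le_two)
  have hP : Continuous fun p : V3 × ℝ => ‖scurl (fun y => J y p.2) p.1‖ ^ 2 := hCJ.norm.pow 2
  have hQ : Continuous fun p : V3 × ℝ =>
      ⟪cross3 (sgrad (fun y => Ne y p.2) p.1) (E p.1 p.2), scurl (fun y => J y p.2) p.1⟫ :=
    (continuous_cross3 (continuous_sgrad hNe) hE.continuous).inner hCJ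
  have hR : Continuous fun p : V3 × ℝ =>
      Ne p.1 p.2 * ⟪scurl (fun y => E y p.2) p.1, scurl (fun y => J y p.2) p.1⟫ :=
    hNe.continuous.mul (hCE.inner hCJ)
  have hderiv (x : V3) (t : ℝ) (ht : t ∈ Set.uIcc 0 T) :
      HasDerivAt (fun s => ‖scurl (fun y => J y s) x‖ ^ 2)
        (-(2 * νe) * ‖scurl (fun y => J y t) x‖ ^ 2
          + 2 * ⟪cross3 (sgrad (fun y => Ne y t) x) (E x t), scurl (fun y => J y t) x⟫
          + 2 * (Ne x t * ⟪scurl (fun y => E y t) x, scurl (fun y => J y t) x⟫)) t := by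
    rw [Set.uIcc_of_le hT.le] at ht
    have hslice : Differentiable ℝ fun y : V3 => (y, t) :=
      differentiable_id.prodMk (differentiable_const t)
    have hcurl : scurl (fun y => deriv (J y) t) x
        = -(νe • scurl (fun y => J y t) x) + (cross3 (sgrad (fun y => Ne y t) x) (E x t)
          + Ne x t • scurl (fun y => E y t) x) := by
      simp_rw [hDrude _ t ht]
      exact scurl_neg_smul_add_smul νe
        (((hJ.differentiable two_ne_zero).comp hslice) x)
        (((hE.differentiable two_ne_zero).comp hslice) x)
        (((hNe.differentiable one_ne_zero).comp hslice) x)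
    have h := (hasDerivAt_scurl hJ x t).norm_sq
    rw [hcurl, real_inner_comm] at h
    convert h using 1
    simp only [inner_add_left, inner_neg_left, real_inner_smul_left,
      real_inner_self_eq_norm_sq]
    ring
  have hmain := intervalIntegral_setIntegral_deriv hΩb
    (f := fun x t => ‖scurl (fun y => J y t) x‖ ^ 2) hP
    (((hP.const_mul (-(2 * νe))).add (hQ.const_mul 2)).add (hR.const_mul 2)) hderiv
  rw [intervalIntegral_setIntegral_linearCombination hΩb
    (f := fun x t => ‖scurl (fun y => J y t) x‖ ^ 2)
    (g := fun x t => ⟪cross3 (sgrad (fun y => Ne y t) x) (E x t), scurl (fun y => J y t) x⟫)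
    (h := fun x t => Ne x t * ⟪scurl (fun y => E y t) x, scurl (fun y => J y t) x⟫)
    hP hQ hR] at hmain
  linarith
end
end
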